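/- arXiv:0907.3770 — 9 statements merged into one kernel-verified Lean document; each statement's English description precedes it below -/
import Mathlib

section
/- Let s be any vertex of V. For every integer k ≥ 1, one has ∑_{i ∈ V} ∑_{t ∈ V} C_i · j_i(s,t) · p^{(k)}_{it} = n − k + ∑_{m=1}^{k−1} tr(P^m). (Generalized Foster identity for voltage values.) -/
open Matrix BigOperators Finset

lemma aux_quad {n : ℕ} (C : Fin n → Fin n → ℝ)
    (hCsymm : ∀ p q, C p q = C q p)
    (v : Fin n → ℝ) (hv : ∀ p, ∑ q, C p q * (v p - v q) = 0) :
    ∑ p, ∑ q, C p q * (v p - v q) ^ 2 = 0 := by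
  have h1 : ∑ p, ∑ q, v p * (C p q * (v p - v q)) = 0 := by
    simp [← Finset.mul_sum, hv]
  have h2 : ∑ p, ∑ q, v q * (C p q * (v p - v q)) = 0 := by
    rw [Finset.sum_comm, ← neg_eq_zero, ← h1, ← Finset.sum_neg_distrib]
    refine Finset.sum_congr rfl fun p _ => ?_
    rw [← Finset.sum_neg_distrib]
    refine Finset.sum_congr rfl fun q _ => ?_
    rw [hCsymm q p]; ring
  rw [← sub_zero (0:ℝ)]
  nth_rewrite 1 [← h1]
  rw [← h2, ← Finset.sum_sub_distrib]
  refine Finset.sum_congr rfl fun p _ => ?_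
  rw [← Finset.sum_sub_distrib]
  refine Finset.sum_congr rfl fun q _ => ?_
  ring

lemma aux_ker {n : ℕ} (C : Fin n → Fin n → ℝ)
    (hCsymm : ∀ p q, C p q = C q p)
    (hCnonneg : ∀ p q, 0 ≤ C p q)
    (hconn : (SimpleGraph.fromRel (fun p q : Fin n => 0 < C p q)).Connected)
    (v : Fin n → ℝ) (hv : ∀ p, ∑ q, C p q * (v p - v q) = 0) (p q : Fin n) :
    v p = v q := by
  have h := aux_quad C hCsymm v hv
  have hadj : ∀ a b, 0 < C a b → v a = v b := by
    intro a b hab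
    have h1 := (Finset.sum_eq_zero_iff_of_nonneg (fun p _ => Finset.sum_nonneg
      fun q _ => mul_nonneg (hCnonneg p q) (sq_nonneg (v p - v q)))).1 h a (Finset.mem_univ _)
    have h2 := (Finset.sum_eq_zero_iff_of_nonneg (fun q _ =>
      mul_nonneg (hCnonneg a q) (sq_nonneg (v a - v q)))).1 h1 b (Finset.mem_univ _)
    have h3 : (v a - v b) ^ 2 = 0 := (mul_eq_zero.1 h2).resolve_left hab.ne'
    exact sub_eq_zero.1 (pow_eq_zero_iff (two_ne_zero) |>.1 h3)
  obtain ⟨w⟩ := hconn.preconnected p q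
  induction w with
  | nil => rfl
  | cons hab _ ih =>
    rw [← ih]
    rw [SimpleGraph.fromRel_adj] at hab
    rcases hab.2 with h | h
    · exact hadj _ _ h
    · exact (hadj _ _ h).symm

lemma aux_L {n : ℕ} (C : Fin n → Fin n → ℝ)
    (hCdiag : ∀ p, C p p = 0)
    (L : Matrix (Fin n) (Fin n) ℝ)
    (hL : ∀ p q, L p q = if p = q then ∑ x, C p x else -C p q)
    (v : Fin n → ℝ) (p : Fin n) :
    ∑ q, L p q * v q = ∑ q, C p q * (v p - v q) := by
  have : ∀ q, L p q * v q = (if p = q then (∑ x, C p x) * v q else 0) - C p q * v q := by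
    intro q
    rw [hL]
    split_ifs with h
    · subst h; rw [hCdiag]; ring
    · ring
  simp only [this, Finset.sum_sub_distrib, mul_sub, Finset.sum_ite_eq, Finset.mem_univ, if_true,
    Finset.sum_mul]

/-- Generalized Foster identity for voltage values. -/
theorem generalized_foster_voltage
    (n : ℕ) (hn : 2 ≤ n)
    (C : Fin n → Fin n → ℝ)
    (hCsymm : ∀ p q, C p q = C q p)
    (hCnonneg : ∀ p q, 0 ≤ C p q)
    (hCdiag : ∀ p, C p p = 0)
    (hconn : (SimpleGraph.fromRel (fun p q : Fin n => 0 < C p q)).Connected)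
    (L : Matrix (Fin n) (Fin n) ℝ)
    (hL : ∀ p q, L p q = if p = q then ∑ x, C p x else -C p q)
    (Lplus : Matrix (Fin n) (Fin n) ℝ)
    (hLp1 : L * Lplus * L = L) (hLp2 : Lplus * L * Lplus = Lplus)
    (hLp3 : (L * Lplus)ᵀ = L * Lplus) (hLp4 : (Lplus * L)ᵀ = Lplus * L)
    (P : Matrix (Fin n) (Fin n) ℝ)
    (hP : ∀ p q, P p q = C p q / (∑ x, C p x))
    (s : Fin n) (k : ℕ) (hk : 1 ≤ k) :
    ∑ i, ∑ t, (∑ x, C i x) * (Lplus i i - Lplus i s - Lplus i t + Lplus s t) * (P ^ k) i t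
      = (n : ℝ) - (k : ℝ) + ∑ m ∈ Finset.Icc 1 (k - 1), (P ^ m).trace := by
  have hker := aux_ker C hCsymm hCnonneg hconn
  have hLv := aux_L C hCdiag L hL
  have hnpos : (0:ℝ) < n := by exact_mod_cast (by omega : 0 < n)
  have hLsymm : Lᵀ = L := by
    ext p q
    rw [Matrix.transpose_apply, hL, hL]
    by_cases h : p = q
    · subst h; rfl
    · rw [if_neg h, if_neg (Ne.symm h), hCsymm]
  -- symmetric matrices annihilated by L with unit row sums
  have hproj : ∀ M : Matrix (Fin n) (Fin n) ℝ, Mᵀ = M → L * M = 0 → (∀ p, ∑ q, M p q = 1) →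
      ∀ p q, M p q = 1 / n := by
    intro M hM hLM hone p q
    have hcol : ∀ a b c, M a c = M b c := by
      intro a b c
      refine hker (fun x => M x c) (fun x => ?_) a b
      refine (hLv (fun x => M x c) x).symm.trans ?_
      have := congrFun (congrFun hLM x) c
      rwa [Matrix.mul_apply] at this
    have hrow : ∀ a b c, M c a = M c b := by
      intro a b c
      have h1 := congrFun (congrFun hM a) c
      have h2 := congrFun (congrFun hM b) c
      rw [Matrix.transpose_apply] at h1 h2
      rw [h1, h2]; exact hcol a b c
    have := hone p
    rw [Finset.sum_congr rfl (fun x _ => hrow x q p)] at this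
    simp at this
    field_simp
    linarith
  have hL1 : ∀ p, ∑ q, L p q = 0 := by
    intro p
    have := hLv (fun _ => 1) p
    simpa using this
  have hL1' : L *ᵥ (fun _ => (1:ℝ)) = 0 := by
    ext p; simpa [Matrix.mulVec, dotProduct] using hL1 p
  have hsum : ∀ (B : Matrix (Fin n) (Fin n) ℝ) (p), ∑ q, (1 - B * L) p q = 1 := by
    intro B p
    have : ((1 - B * L) *ᵥ (fun _ => (1:ℝ))) p = 1 := by
      rw [Matrix.sub_mulVec, ← Matrix.mulVec_mulVec, hL1']; simp
    simpa [Matrix.mulVec, dotProduct] using this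
  have hAL : ∀ p q, (1 - Lplus * L) p q = 1 / n := by
    refine hproj _ ?_ ?_ (hsum _)
    · rw [Matrix.transpose_sub, hLp4, Matrix.transpose_one]
    · rw [Matrix.mul_sub, ← Matrix.mul_assoc, hLp1]; simp
  have e1 : Lplusᵀ * L = L * Lplus := by
    rw [← hLp3, Matrix.transpose_mul, hLsymm]
  have e2 : L * Lplusᵀ = Lplus * L := by
    rw [← hLp4, Matrix.transpose_mul, hLsymm]
  have hLA : ∀ p q, (1 - L * Lplus) p q = 1 / n := by
    refine hproj _ ?_ ?_ ?_
    · rw [Matrix.transpose_sub, hLp3, Matrix.transpose_one]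
    · have := congrArg Matrix.transpose hLp1
      rw [Matrix.transpose_mul, Matrix.transpose_mul, hLsymm, e1, ← Matrix.mul_assoc] at this
      rw [Matrix.mul_sub, ← Matrix.mul_assoc, this]; simp
    · rw [← e1]; exact hsum _
  have hcomm : L * Lplus = Lplus * L := by
    have : 1 - L * Lplus = 1 - Lplus * L := by
      ext p q; rw [hLA, hAL]
    exact sub_right_injective this
  have hAsymm : Lplusᵀ = Lplus := by
    have h := congrArg Matrix.transpose hLp2
    rw [Matrix.transpose_mul, Matrix.transpose_mul, hLsymm] at h
    rw [← h, ← Matrix.mul_assoc, e1, hcomm, Matrix.mul_assoc, e2, ← hcomm, ← Matrix.mul_assoc,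
      hLp2]
  have hA : ∀ p q, Lplus p q = Lplus q p := fun p q => by
    conv_lhs => rw [← hAsymm]
    rfl
  have hd : ∀ p, (∑ x, C p x) ≠ 0 := by
    intro p h0
    have hz : ∀ q, C p q = 0 := fun q =>
      (Finset.sum_eq_zero_iff_of_nonneg (fun q _ => hCnonneg p q)).1 h0 q (Finset.mem_univ _)
    have : Nontrivial (Fin n) := Fin.nontrivial_iff_two_le.2 hn
    obtain ⟨q, hq⟩ := exists_ne p
    have := hker (fun x => if x = p then 1 else 0) (fun a => by
      refine Finset.sum_eq_zero fun b _ => ?_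
      by_cases ha : a = p
      · rw [ha, hz]; simp
      · by_cases hb : b = p
        · rw [hb, hCsymm, hz]; simp
        · simp [ha, hb]) p q
    simp [hq] at this
  set d : Fin n → ℝ := fun i => ∑ x, C i x with hdd
  have hdP : ∀ i t, d i * P i t = C i t := by
    intro i t; rw [hP]; exact mul_div_cancel₀ _ (hd i)
  have hrow : ∀ m i, ∑ t, (P ^ m) i t = 1 := by
    have hP1 : P *ᵥ (fun _ => (1:ℝ)) = fun _ => 1 := by
      ext i
      simp only [Matrix.mulVec, dotProduct, mul_one, hP]
      rw [← Finset.sum_div]; exact div_self (hd i)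
    have : ∀ m : ℕ, (P ^ m) *ᵥ (fun _ => (1:ℝ)) = fun _ => 1 := by
      intro m
      induction m with
      | zero => simp
      | succ m ih => rw [pow_succ, ← Matrix.mulVec_mulVec, hP1, ih]
    intro m i
    simpa [Matrix.mulVec, dotProduct] using congrFun (this m) i
  have hcol : ∀ m t, ∑ i, d i * (P ^ m) i t = d t := by
    have hP1 : d ᵥ* P = d := by
      ext t
      simp only [Matrix.vecMul, dotProduct, hdP]
      exact Finset.sum_congr rfl fun i _ => hCsymm i t
    have : ∀ m : ℕ, d ᵥ* (P ^ m) = d := by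
      intro m
      induction m with
      | zero => simp
      | succ m ih => rw [pow_succ, ← Matrix.vecMul_vecMul, ih, hP1]
    intro m t
    simpa [Matrix.vecMul, dotProduct] using congrFun (this m) t
  have hLD : L = Matrix.diagonal d * (1 - P) := by
    ext i t
    rw [Matrix.diagonal_mul, Matrix.sub_apply, mul_sub, hdP, hL, Matrix.one_apply]
    split_ifs with h
    · subst h; rw [hCdiag]; simp [hdd]
    · simp
  have hstep : ∀ m : ℕ, (L * P ^ m * Lplus).trace = (P ^ m).trace - 1 := by
    intro m
    rw [Matrix.mul_assoc, Matrix.trace_mul_comm, Matrix.mul_assoc]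
    have : Lplus * L = 1 - (1 - Lplus * L) := by abel
    rw [this, Matrix.mul_sub, Matrix.mul_one, Matrix.trace_sub]
    congr 1
    simp only [Matrix.trace, Matrix.diag_apply, Matrix.mul_apply (M := P ^ m), hAL]
    simp only [← Finset.sum_mul, hrow]
    simp
    field_simp
  have htel : ∀ m : ℕ, (Matrix.diagonal d * Lplus).trace
      - (Matrix.diagonal d * P ^ m * Lplus).trace = ∑ j ∈ Finset.range m, ((P ^ j).trace - 1) := by
    intro m
    induction m with
    | zero => simp
    | succ m ih =>
      rw [Finset.sum_range_succ, ← ih, ← hstep, hLD, Matrix.mul_sub, Matrix.mul_one, Matrix.sub_mul,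
        Matrix.sub_mul, Matrix.trace_sub, pow_succ', ← Matrix.mul_assoc]
      ring
  have hS : ∑ i, ∑ t, d i * (Lplus i i - Lplus i s - Lplus i t + Lplus s t) * (P ^ k) i t
      = (Matrix.diagonal d * Lplus).trace - (Matrix.diagonal d * P ^ k * Lplus).trace := by
    have t1 : ∑ i, ∑ t, d i * (Lplus i i - Lplus i s) * (P ^ k) i t
        = ∑ i, d i * (Lplus i i - Lplus i s) := by
      simp only [← Finset.mul_sum, hrow, mul_one]
    have t2 : ∑ i, ∑ t, Lplus s t * (d i * (P ^ k) i t) = ∑ i, d i * Lplus i s := by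
      rw [Finset.sum_comm]
      simp only [← Finset.mul_sum, hcol]
      exact Finset.sum_congr rfl fun i _ => by rw [hA s i]; ring
    have t3 : (Matrix.diagonal d * P ^ k * Lplus).trace
        = ∑ i, ∑ t, d i * (P ^ k) i t * Lplus i t := by
      simp only [Matrix.trace, Matrix.diag_apply, Matrix.mul_apply (N := Lplus),
        Matrix.diagonal_mul]
      exact Finset.sum_congr rfl fun i _ => Finset.sum_congr rfl fun t _ => by rw [hA t i]
    have t4 : (Matrix.diagonal d * Lplus).trace = ∑ i, d i * Lplus i i := by
      simp [Matrix.trace, Matrix.diagonal_mul]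
    have t5 : ∑ i, ∑ t, d i * (Lplus i i - Lplus i s - Lplus i t + Lplus s t) * (P ^ k) i t
        = ∑ i, ∑ t, d i * (Lplus i i - Lplus i s) * (P ^ k) i t
          + ∑ i, ∑ t, Lplus s t * (d i * (P ^ k) i t)
          - ∑ i, ∑ t, d i * (P ^ k) i t * Lplus i t := by
      simp only [← Finset.sum_add_distrib, ← Finset.sum_sub_distrib]
      exact Finset.sum_congr rfl fun i _ => Finset.sum_congr rfl fun t _ => by ring
    rw [t5, t1, t2, t3, t4]
    simp only [mul_sub, Finset.sum_sub_distrib]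
    ring
  refine hS.trans ((htel k).trans ?_)
  obtain ⟨j, rfl⟩ : ∃ j, k = j + 1 := ⟨k - 1, by omega⟩
  rw [Nat.add_sub_cancel]
  clear hS hk
  induction j with
  | zero => simp
  | succ j ih =>
    rw [Finset.sum_range_succ, ih, Finset.sum_Icc_succ_top (by omega)]
    push_cast
    ring
end

section
/- For every integer k ≥ 1, one has (1/2) ∑_{i ∈ V} ∑_{t ∈ V} C_i · r(i,t) · p^{(k)}_{it} = n − k + ∑_{m=1}^{k−1} tr(P^m). (Extended Foster identities.) -/
open Matrix BigOperators Finset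

theorem const_of_adj {n : ℕ} (C : Fin n → Fin n → ℝ)
    (hCsymm : ∀ p q, C p q = C q p)
    (hconn : (SimpleGraph.fromRel (fun p q : Fin n => 0 < C p q)).Connected)
    (f : Fin n → ℝ) (hf : ∀ p q, 0 < C p q → f p = f q) (a b : Fin n) : f a = f b := by
  obtain ⟨w⟩ := hconn.preconnected a b
  induction w with
  | nil => rfl
  | cons h _ ih =>
    rw [← ih]
    rw [SimpleGraph.fromRel_adj] at h
    rcases h.2 with h | h
    · exact hf _ _ h
    · exact (hf _ _ h).symm

theorem total_pos {n : ℕ} (hn : 2 ≤ n) (C : Fin n → Fin n → ℝ)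
    (hCsymm : ∀ p q, C p q = C q p)
    (hCnonneg : ∀ p q, 0 ≤ C p q)
    (hconn : (SimpleGraph.fromRel (fun p q : Fin n => 0 < C p q)).Connected)
    (i : Fin n) : 0 < ∑ x, C i x := by
  rcases (Finset.sum_nonneg (fun x _ => hCnonneg i x)).lt_or_eq with h | h
  · exact h
  exfalso
  have h0 : ∀ x, C i x = 0 := fun x =>
    (Finset.sum_eq_zero_iff_of_nonneg (fun x _ => hCnonneg i x)).1 h.symm x (Finset.mem_univ x)
  have : Nontrivial (Fin n) := Fin.nontrivial_iff_two_le.2 hn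
  obtain ⟨j, hj⟩ := exists_ne i
  have := const_of_adj C hCsymm hconn (fun x => if x = i then 1 else 0) (by
    intro p q hpq
    have hp : p ≠ i := by
      rintro rfl
      rw [h0] at hpq
      exact lt_irrefl _ hpq
    have hq : q ≠ i := by
      rintro rfl
      rw [hCsymm, h0] at hpq
      exact lt_irrefl _ hpq
    simp [hp, hq]) i j
  simp [hj] at this

theorem ker_const {n : ℕ} (C : Fin n → Fin n → ℝ)
    (hCsymm : ∀ p q, C p q = C q p)
    (hCnonneg : ∀ p q, 0 ≤ C p q)
    (hconn : (SimpleGraph.fromRel (fun p q : Fin n => 0 < C p q)).Connected)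
    (f : Fin n → ℝ) (hf : ∀ p, (∑ x, C p x) * f p - ∑ q, C p q * f q = 0)
    (a b : Fin n) : f a = f b := by
  have h1 : ∑ p, ∑ q, C p q * (f p * f p - f p * f q) = 0 := by
    apply Finset.sum_eq_zero
    intro p _
    have := congrArg (fun z => f p * z) (hf p)
    simp only [mul_zero] at this
    rw [← this, Finset.sum_mul, ← Finset.sum_sub_distrib, Finset.mul_sum]
    exact Finset.sum_congr rfl fun q _ => by ring
  have h2 : ∑ p, ∑ q, C p q * (f q * f q - f p * f q) = 0 := by
    rw [Finset.sum_comm, ← h1]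
    refine Finset.sum_congr rfl fun p _ => Finset.sum_congr rfl fun q _ => ?_
    rw [hCsymm q p]; ring
  have h3 : ∑ p, ∑ q, C p q * (f p - f q) ^ 2 = 0 := by
    have : ∑ p, ∑ q, C p q * (f p - f q) ^ 2 = ∑ p, ∑ q, C p q * (f p * f p - f p * f q)
        + ∑ p, ∑ q, C p q * (f q * f q - f p * f q) := by
      simp only [← Finset.sum_add_distrib]
      refine Finset.sum_congr rfl fun p _ => Finset.sum_congr rfl fun q _ => ?_
      ring
    rw [this, h1, h2, add_zero]
  have hn0 : ∀ p q, 0 ≤ C p q * (f p - f q) ^ 2 := fun p q =>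
    mul_nonneg (hCnonneg p q) (sq_nonneg _)
  refine const_of_adj C hCsymm hconn f (fun p q hpq => ?_) a b
  have h4 := (Finset.sum_eq_zero_iff_of_nonneg
    (fun p _ => Finset.sum_nonneg fun q _ => hn0 p q)).1 h3 p (Finset.mem_univ p)
  have h5 := (Finset.sum_eq_zero_iff_of_nonneg (fun q _ => hn0 p q)).1 h4 q (Finset.mem_univ q)
  rcases mul_eq_zero.1 h5 with h | h
  · exact absurd h hpq.ne'
  · exact sub_eq_zero.1 (pow_eq_zero_iff (two_ne_zero) |>.1 h)

/-- Extended Foster identities. -/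
theorem extended_foster
    (n : ℕ) (hn : 2 ≤ n)
    (C : Fin n → Fin n → ℝ)
    (hCsymm : ∀ p q, C p q = C q p)
    (hCnonneg : ∀ p q, 0 ≤ C p q)
    (hCdiag : ∀ p, C p p = 0)
    (hconn : (SimpleGraph.fromRel (fun p q : Fin n => 0 < C p q)).Connected)
    (L : Matrix (Fin n) (Fin n) ℝ)
    (hL : ∀ p q, L p q = if p = q then ∑ x, C p x else -C p q)
    (Lplus : Matrix (Fin n) (Fin n) ℝ)
    (hLp1 : L * Lplus * L = L) (hLp2 : Lplus * L * Lplus = Lplus)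
    (hLp3 : (L * Lplus)ᵀ = L * Lplus) (hLp4 : (Lplus * L)ᵀ = Lplus * L)
    (P : Matrix (Fin n) (Fin n) ℝ)
    (hP : ∀ p q, P p q = C p q / (∑ x, C p x))
    (k : ℕ) (hk : 1 ≤ k) :
    (1 / 2) * ∑ i, ∑ t, (∑ x, C i x) * (Lplus i i - 2 * Lplus i t + Lplus t t) * (P ^ k) i t
      = (n : ℝ) - (k : ℝ) + ∑ m ∈ Finset.Icc 1 (k - 1), (P ^ m).trace := by
  have hpos := total_pos hn C hCsymm hCnonneg hconn
  set D : Matrix (Fin n) (Fin n) ℝ := Matrix.diagonal (fun i => ∑ x, C i x) with hD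
  have hDP : D * P = Matrix.of C := by
    ext i j
    rw [hD, Matrix.diagonal_mul, hP, Matrix.of_apply]
    exact mul_div_cancel₀ _ (hpos i).ne'
  have hLD : L = D - D * P := by
    rw [hDP]
    ext i j
    rw [hL, Matrix.sub_apply, hD, Matrix.diagonal_apply, Matrix.of_apply]
    split_ifs with h
    · rw [← h, hCdiag, sub_zero]
    · rw [zero_sub]
  have hDT : Dᵀ = D := Matrix.diagonal_transpose _
  have hCT : (Matrix.of C)ᵀ = Matrix.of C := by
    ext i j
    exact hCsymm j i
  have hPD : Pᵀ * D = D * P := by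
    rw [hDP, ← hCT, ← hDP, Matrix.transpose_mul, hDT]
  have hLT : Lᵀ = L := by
    rw [hLD, Matrix.transpose_sub, Matrix.transpose_mul, hDT, hPD]
  have hcomm : ∀ m : ℕ, (Pᵀ) ^ m * D = D * P ^ m := by
    intro m
    induction m with
    | zero => simp
    | succ m ih => rw [pow_succ, Matrix.mul_assoc, hPD, ← Matrix.mul_assoc, ih, Matrix.mul_assoc,
        ← pow_succ]
  have hDPT : ∀ m : ℕ, (D * P ^ m)ᵀ = D * P ^ m := by
    intro m
    rw [Matrix.transpose_mul, hDT, Matrix.transpose_pow, hcomm]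
  have hrow1 : P *ᵥ 1 = 1 := by
    ext i
    simp only [Matrix.mulVec, dotProduct, Pi.one_apply, mul_one, hP]
    rw [← Finset.sum_div]
    exact div_self (hpos i).ne'
  have hrow : ∀ m : ℕ, (P ^ m) *ᵥ 1 = 1 := by
    intro m
    induction m with
    | zero => simp
    | succ m ih => rw [pow_succ, ← Matrix.mulVec_mulVec, hrow1, ih]
  have hrow' : ∀ (m : ℕ) i, ∑ t, (P ^ m) i t = 1 := by
    intro m i
    have := congrFun (hrow m) i
    simpa [Matrix.mulVec, dotProduct] using this
  -- the projection onto constants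
  set Q : Matrix (Fin n) (Fin n) ℝ := 1 - L * Lplus with hQ
  have hQT : Qᵀ = Q := by rw [hQ, Matrix.transpose_sub, hLp3, Matrix.transpose_one]
  have hLQ : L * Q = 0 := by
    have : Q * L = 0 := by rw [hQ, Matrix.sub_mul, Matrix.one_mul, hLp1, sub_self]
    have h2 := congrArg Matrix.transpose this
    rwa [Matrix.transpose_mul, hLT, hQT, Matrix.transpose_zero] at h2
  have hQc : ∀ j a b, Q a j = Q b j := by
    intro j a b
    refine ker_const C hCsymm hCnonneg hconn (fun a => Q a j) (fun p => ?_) a b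
    have := congrFun (congrFun hLQ p) j
    rw [hLD, hDP, Matrix.sub_mul, Matrix.sub_apply, hD, Matrix.diagonal_mul, Matrix.mul_apply] at this
    simpa using this
  have hL1 : L *ᵥ 1 = 0 := by
    rw [hLD, Matrix.sub_mulVec, ← Matrix.mulVec_mulVec, hrow1, sub_self]
  have hQ1 : Q *ᵥ 1 = 1 := by
    have : (L * Lplus) *ᵥ 1 = 0 := by
      rw [← hLp3, Matrix.transpose_mul, hLT, ← Matrix.mulVec_mulVec, hL1, Matrix.mulVec_zero]
    rw [hQ, Matrix.sub_mulVec, this, Matrix.one_mulVec, sub_zero]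
  have hQall : ∀ a b c d, Q a b = Q c d := by
    intro a b c d
    have hs : Q d b = Q b d := congrFun (congrFun hQT b) d
    rw [hQc b a d, hs, hQc d b c]
  have htrQ : ∀ m : ℕ, ((Pᵀ) ^ m * Q).trace = 1 := by
    intro m
    rw [← Matrix.transpose_pow, Matrix.trace]
    simp only [Matrix.diag_apply, Matrix.mul_apply, Matrix.transpose_apply]
    rw [Finset.sum_comm]
    have i0 : Fin n := ⟨0, by omega⟩
    have : ∀ j, ∑ i, (P ^ m) j i * Q j i = Q i0 j := by
      intro j
      rw [Finset.sum_congr rfl (fun i _ => by rw [hQall j i i0 j]), ← Finset.sum_mul, hrow', one_mul]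
    have h3 := congrFun hQ1 i0
    simp only [Matrix.mulVec, dotProduct, Pi.one_apply, mul_one] at h3
    rw [← h3]
    exact Finset.sum_congr rfl fun j _ => this j
  have hstep : ∀ m : ℕ, (D * (1 - P ^ (m + 1)) * Lplus).trace
      = (D * (1 - P ^ m) * Lplus).trace + ((P ^ m).trace - 1) := by
    intro m
    have h1 : D * (1 - P ^ (m + 1)) * Lplus
        = D * (1 - P ^ m) * Lplus + ((Pᵀ) ^ m - (Pᵀ) ^ m * Q) := by
      have : (Pᵀ) ^ m - (Pᵀ) ^ m * Q = (D * P ^ m - D * P ^ m * P) * Lplus := by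
        rw [hQ, Matrix.mul_sub, Matrix.mul_one, sub_sub_cancel, ← hcomm, hLD,
          Matrix.mul_assoc _ D P, ← Matrix.mul_sub, Matrix.mul_assoc]
      rw [this, pow_succ]
      noncomm_ring
    rw [h1, Matrix.trace_add, Matrix.trace_sub, htrQ, ← Matrix.transpose_pow,
      Matrix.trace_transpose]
  have hS : ∀ m : ℕ, (D * (1 - P ^ (m + 1)) * Lplus).trace
      = (n : ℝ) - ((m + 1 : ℕ) : ℝ) + ∑ j ∈ Finset.Icc 1 m, (P ^ j).trace := by
    intro m
    induction m with
    | zero =>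
      rw [hstep]
      simp
    | succ m ih =>
      rw [hstep, ih, Finset.sum_Icc_succ_top (by omega)]
      push_cast
      ring
  obtain ⟨m, rfl⟩ : ∃ m, k = m + 1 := ⟨k - 1, by omega⟩
  rw [Nat.add_sub_cancel, ← hS]
  have hentry : ∀ i t, (D * P ^ (m + 1)) i t = (∑ x, C i x) * (P ^ (m + 1)) i t := by
    intro i t
    rw [hD, Matrix.diagonal_mul]
  have e1 : ∑ i, ∑ t, Lplus i i * (D * P ^ (m + 1)) i t = ∑ i, (∑ x, C i x) * Lplus i i := by
    refine Finset.sum_congr rfl fun i _ => ?_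
    simp only [hentry]
    rw [← Finset.mul_sum, ← Finset.mul_sum, hrow', mul_one, mul_comm]
  have e2 : ∑ i, ∑ t, Lplus t t * (D * P ^ (m + 1)) i t = ∑ i, (∑ x, C i x) * Lplus i i := by
    rw [Finset.sum_comm, ← e1]
    refine Finset.sum_congr rfl fun i _ => Finset.sum_congr rfl fun t _ => ?_
    rw [← hDPT, Matrix.transpose_apply, hDPT]
  have e3 : ∑ i, ∑ t, Lplus i t * (D * P ^ (m + 1)) i t = (D * P ^ (m + 1) * Lplus).trace := by
    rw [Matrix.trace, Finset.sum_comm]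
    refine Finset.sum_congr rfl fun t _ => ?_
    rw [Matrix.diag_apply, Matrix.mul_apply]
    refine Finset.sum_congr rfl fun i _ => ?_
    rw [← hDPT, Matrix.transpose_apply, hDPT, mul_comm]
  have e4 : (D * Lplus).trace = ∑ i, (∑ x, C i x) * Lplus i i := by
    rw [Matrix.trace]
    refine Finset.sum_congr rfl fun i _ => ?_
    rw [Matrix.diag_apply, hD, Matrix.diagonal_mul]
  have e5 : ∑ i, ∑ t, (∑ x, C i x) * (Lplus i i - 2 * Lplus i t + Lplus t t) * (P ^ (m + 1)) i t
      = ∑ i, ∑ t, Lplus i i * (D * P ^ (m + 1)) i t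
        - 2 * ∑ i, ∑ t, Lplus i t * (D * P ^ (m + 1)) i t
        + ∑ i, ∑ t, Lplus t t * (D * P ^ (m + 1)) i t := by
    simp only [Finset.mul_sum]
    simp only [← Finset.sum_sub_distrib, ← Finset.sum_add_distrib]
    refine Finset.sum_congr rfl fun i _ => Finset.sum_congr rfl fun t _ => ?_
    rw [hentry]; ring
  rw [e5, e1, e2, e3, Matrix.mul_sub, Matrix.mul_one, Matrix.sub_mul, Matrix.trace_sub, e4]
  ring
end

section
/- Let H and H' be any two n×n real matrices that are generalized inverses of L, i.e. L H L = L and L H' L = L. Then for all vertices p, q ∈ V, H_{pp} − H_{pq} − H_{qp} + H_{qq} = H'_{pp} − H'_{pq} − H'_{qp} + H'_{qq}; in particular this common value equals l⁺_{pp} − 2 l⁺_{pq} + l⁺_{qq}, the resistance r(p,q). (Resistance is well-defined via any generalized inverse of the Laplacian.) -/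
open Matrix BigOperators Finset

theorem ker_const_s4 (n : ℕ) (C : Fin n → Fin n → ℝ)
    (hCsymm : ∀ p q, C p q = C q p)
    (hCnonneg : ∀ p q, 0 ≤ C p q)
    (hCdiag : ∀ p, C p p = 0)
    (hconn : (SimpleGraph.fromRel (fun p q : Fin n => 0 < C p q)).Connected)
    (L : Matrix (Fin n) (Fin n) ℝ)
    (hL : ∀ p q, L p q = if p = q then ∑ x, C p x else -C p q)
    (v : Fin n → ℝ) (hv : ∀ i, ∑ j, L i j * v j = 0) (p q : Fin n) : v p = v q := by
  have h1 : ∀ i, ∑ j, C i j * (v i - v j) = 0 := by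
    intro i
    rw [← hv i]
    have h2 : ∀ j, L i j * v j = (if i = j then (∑ x, C i x) * v i else 0) - C i j * v j := by
      intro j
      rw [hL]
      split_ifs with h
      · subst h; rw [hCdiag]; ring
      · ring
    simp_rw [h2]
    simp [Finset.sum_sub_distrib, mul_sub, Finset.sum_mul]
  have h3 : ∑ i, ∑ j, C i j * (v i - v j) ^ 2 = 0 := by
    have e1 : ∑ i, ∑ j, C i j * (v i - v j) * v i = 0 := by
      refine Finset.sum_eq_zero fun i _ => ?_
      rw [← Finset.sum_mul, h1, zero_mul]
    have e2 : ∑ i, ∑ j, C i j * (v j - v i) * v j = 0 := by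
      rw [Finset.sum_comm, ← e1]
      refine Finset.sum_congr rfl fun i _ => Finset.sum_congr rfl fun j _ => ?_
      rw [hCsymm]
    calc _ = ∑ i, ∑ j, C i j * (v i - v j) * v i + ∑ i, ∑ j, C i j * (v j - v i) * v j := by
          simp_rw [← Finset.sum_add_distrib]
          refine Finset.sum_congr rfl fun i _ => Finset.sum_congr rfl fun j _ => ?_
          ring
      _ = 0 := by rw [e1, e2, add_zero]
  have hnn : ∀ i j, 0 ≤ C i j * (v i - v j) ^ 2 := fun i j =>
    mul_nonneg (hCnonneg i j) (sq_nonneg _)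
  have h4 : ∀ i j, C i j * (v i - v j) ^ 2 = 0 := by
    intro i j
    have a := (Finset.sum_eq_zero_iff_of_nonneg
      (fun i _ => Finset.sum_nonneg fun j _ => hnn i j)).1 h3 i (Finset.mem_univ _)
    exact (Finset.sum_eq_zero_iff_of_nonneg (fun j _ => hnn i j)).1 a j (Finset.mem_univ _)
  have h5 : ∀ i j, 0 < C i j → v i = v j := by
    intro i j h
    have := (mul_eq_zero.1 (h4 i j)).resolve_left h.ne'
    exact sub_eq_zero.1 (pow_eq_zero_iff (two_ne_zero) |>.1 this)
  obtain ⟨w⟩ := hconn.preconnected p q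
  induction w with
  | nil => rfl
  | cons h _ ih =>
    rw [← ih]
    rw [SimpleGraph.fromRel_adj] at h
    rcases h.2 with h | h
    · exact h5 _ _ h
    · exact (h5 _ _ h).symm

/-- Resistance is well-defined via any generalized inverse of the Laplacian. -/
theorem resistance_generalized_inverse
    (n : ℕ) (hn : 2 ≤ n)
    (C : Fin n → Fin n → ℝ)
    (hCsymm : ∀ p q, C p q = C q p)
    (hCnonneg : ∀ p q, 0 ≤ C p q)
    (hCdiag : ∀ p, C p p = 0)
    (hconn : (SimpleGraph.fromRel (fun p q : Fin n => 0 < C p q)).Connected)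
    (L : Matrix (Fin n) (Fin n) ℝ)
    (hL : ∀ p q, L p q = if p = q then ∑ x, C p x else -C p q)
    (Lplus : Matrix (Fin n) (Fin n) ℝ)
    (hLp1 : L * Lplus * L = L) (hLp2 : Lplus * L * Lplus = Lplus)
    (hLp3 : (L * Lplus)ᵀ = L * Lplus) (hLp4 : (Lplus * L)ᵀ = Lplus * L)
    (H H' : Matrix (Fin n) (Fin n) ℝ)
    (hH : L * H * L = L) (hH' : L * H' * L = L)
    (p q : Fin n) :
    H p p - H p q - H q p + H q q = H' p p - H' p q - H' q p + H' q q ∧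
    H p p - H p q - H q p + H q q = Lplus p p - 2 * Lplus p q + Lplus q q := by
  have hLT : Lᵀ = L := by
    ext i j
    rw [Matrix.transpose_apply, hL, hL]
    by_cases h : i = j
    · subst h; rfl
    · rw [if_neg h, if_neg (Ne.symm h), hCsymm]
  have hY : L * Lplusᵀ * L = L := by
    have := congrArg Matrix.transpose hLp1
    simpa [Matrix.transpose_mul, hLT, Matrix.mul_assoc] using this
  have h3 : Lplusᵀ * L = L * Lplus := by
    simpa [Matrix.transpose_mul, hLT] using hLp3
  have h4 : L * Lplusᵀ = Lplus * L := by
    simpa [Matrix.transpose_mul, hLT] using hLp4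
  have hXY : L * Lplus = L * Lplusᵀ := by
    calc L * Lplus = Lplusᵀ * L := h3.symm
      _ = Lplusᵀ * (L * Lplus * L) := by rw [hLp1]
      _ = (Lplusᵀ * L) * (Lplus * L) := by simp only [Matrix.mul_assoc]
      _ = (L * Lplus) * (L * Lplusᵀ) := by rw [h3, h4]
      _ = (L * Lplus * L) * Lplusᵀ := by simp only [Matrix.mul_assoc]
      _ = L * Lplusᵀ := by rw [hLp1]
  have hcomm : Lplus * L = L * Lplus := by rw [hXY, h4]
  have hsym : Lplusᵀ = Lplus := by
    have a := congrArg Matrix.transpose hLp2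
    simp only [Matrix.transpose_mul, hLT] at a
    calc Lplusᵀ = Lplusᵀ * (L * Lplusᵀ) := a.symm
      _ = (Lplusᵀ * L) * Lplus := by rw [← hXY, Matrix.mul_assoc]
      _ = Lplus * L * Lplus := by rw [h3, hcomm]
      _ = Lplus := hLp2
  -- the complementary projection has constant columns
  have hM : L * (1 - Lplus * L) = 0 := by
    rw [Matrix.mul_sub, Matrix.mul_one, ← Matrix.mul_assoc, hLp1, sub_self]
  have hcol : ∀ i j k, (1 - Lplus * L) i k = (1 - Lplus * L) j k := by
    intro i j k
    refine ker_const_s4 n C hCsymm hCnonneg hCdiag hconn L hL (fun i => (1 - Lplus * L) i k) ?_ i j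
    intro i
    have := congrFun (congrFun hM i) k
    rwa [Matrix.mul_apply] at this
  have hMT : (1 - Lplus * L)ᵀ = 1 - Lplus * L := by
    rw [Matrix.transpose_sub, hLp4, Matrix.transpose_one]
  have hrow : ∀ i j k, (1 - Lplus * L) k i = (1 - Lplus * L) k j := by
    intro i j k
    have := hcol i j k
    rw [← hMT]
    exact this
  set w : Fin n → ℝ := Pi.single p 1 - Pi.single q 1 with hw
  have hMw : (1 - Lplus * L) *ᵥ w = 0 := by
    ext k
    rw [hw, Matrix.mulVec_sub]
    simp only [Matrix.mulVec_single_one, Pi.sub_apply, Matrix.col_apply, Pi.zero_apply]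
    rw [hrow p q k, sub_self]
  have hw1 : L *ᵥ (Lplus *ᵥ w) = w := by
    rw [Matrix.sub_mulVec, Matrix.one_mulVec, sub_eq_zero, hcomm] at hMw
    rw [Matrix.mulVec_mulVec, ← hMw]
  have hq : ∀ K : Matrix (Fin n) (Fin n) ℝ,
      w ⬝ᵥ (K *ᵥ w) = K p p - K p q - K q p + K q q := by
    intro K
    rw [hw, Matrix.mulVec_sub]
    simp [sub_dotProduct, dotProduct_sub]
    ring
  have key : ∀ K : Matrix (Fin n) (Fin n) ℝ, L * K * L = L →
      K p p - K p q - K q p + K q q = (Lplus *ᵥ w) ⬝ᵥ (L *ᵥ (Lplus *ᵥ w)) := by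
    intro K hK
    rw [← hq]
    generalize Lplus *ᵥ w = x at hw1 ⊢
    rw [← hw1]
    conv_rhs => rw [← hK]
    conv_lhs => rw [← hLT]
    rw [Matrix.mulVec_transpose, ← Matrix.dotProduct_mulVec, ← Matrix.mulVec_transpose, hLT]
    simp only [Matrix.mulVec_mulVec, Matrix.mul_assoc]
  refine ⟨by rw [key H hH, key H' hH'], ?_⟩
  rw [key H hH, ← key Lplus hLp1]
  have : Lplus q p = Lplus p q := congrFun (congrFun hsym p) q
  rw [this]; ring
end

section
/- Let H be any n×n real matrix with L H L = L, and for vertices x, y define r_H(x,y) = H_{xx} − H_{xy} − H_{yx} + H_{yy}. Then for all vertices p, q, s ∈ V, (1/2)·(r_H(q,p) + r_H(s,p) − r_H(q,s)) = l⁺_{pp} − l⁺_{pq} − l⁺_{ps} + l⁺_{qs}. (The voltage value j_p(q,s) is expressed through the pseudoinverse of the Laplacian.) -/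
open Matrix BigOperators Finset

/-- The kernel of the Laplacian of a connected weighted graph consists of constants. -/
lemma lap_ker_const
    (n : ℕ) (C : Fin n → Fin n → ℝ)
    (hCsymm : ∀ p q, C p q = C q p)
    (hCnonneg : ∀ p q, 0 ≤ C p q)
    (hCdiag : ∀ p, C p p = 0)
    (hconn : (SimpleGraph.fromRel (fun p q : Fin n => 0 < C p q)).Connected)
    (L : Matrix (Fin n) (Fin n) ℝ)
    (hL : ∀ p q, L p q = if p = q then ∑ x, C p x else -C p q)
    (v : Fin n → ℝ) (hv : ∀ p, ∑ q, L p q * v q = 0) (i j : Fin n) : v i = v j := by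
  have h1 : ∀ p, ∑ q, C p q * (v p - v q) = 0 := by
    intro p
    have h2 : ∀ q, L p q * v q = (if p = q then (∑ x, C p x) * v p else 0) - C p q * v q := by
      intro q
      rw [hL]
      split_ifs with h
      · subst h; rw [hCdiag]; ring
      · ring
    have h3 := hv p
    simp only [h2, Finset.sum_sub_distrib, Finset.sum_ite_eq, Finset.mem_univ, if_true] at h3
    simp only [mul_sub, Finset.sum_sub_distrib, ← Finset.sum_mul]
    exact h3
  have hA : ∑ p, ∑ q, C p q * (v p - v q) * v p = 0 := by
    simp only [← Finset.sum_mul, h1]; simp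
  have hB : ∑ p, ∑ q, C p q * (v q - v p) * v q = 0 := by
    rw [Finset.sum_comm, ← hA]
    refine Finset.sum_congr rfl fun p _ => Finset.sum_congr rfl fun q _ => ?_
    rw [hCsymm]
  have hE : ∑ p, ∑ q, C p q * (v p - v q) ^ 2 = 0 := by
    have h4 : ∀ p q, C p q * (v p - v q) ^ 2
        = C p q * (v p - v q) * v p + C p q * (v q - v p) * v q := by
      intro p q; ring
    simp only [h4, Finset.sum_add_distrib, hA, hB, add_zero]
  have hnn : ∀ p q, 0 ≤ C p q * (v p - v q) ^ 2 := fun p q =>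
    mul_nonneg (hCnonneg p q) (sq_nonneg _)
  have hz : ∀ p q, C p q * (v p - v q) ^ 2 = 0 := by
    intro p q
    have h5 := (Finset.sum_eq_zero_iff_of_nonneg
      (fun p _ => Finset.sum_nonneg fun q _ => hnn p q)).1 hE p (Finset.mem_univ p)
    exact (Finset.sum_eq_zero_iff_of_nonneg (fun q _ => hnn p q)).1 h5 q (Finset.mem_univ q)
  have hadj : ∀ p q, 0 < C p q → v p = v q := by
    intro p q hpq
    rcases mul_eq_zero.1 (hz p q) with h | h
    · exact absurd h hpq.ne'
    · exact sub_eq_zero.1 (pow_eq_zero_iff (two_ne_zero)|>.1 h)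
  obtain ⟨w⟩ := hconn.preconnected i j
  induction w with
  | nil => rfl
  | cons h _ ih =>
    rw [← ih]
    rw [SimpleGraph.fromRel_adj] at h
    rcases h.2 with h | h
    · exact hadj _ _ h
    · exact (hadj _ _ h).symm

/-- The pseudoinverse of a symmetric matrix is symmetric. -/
lemma pinv_symm {n : ℕ} (L K : Matrix (Fin n) (Fin n) ℝ) (hs : Lᵀ = L)
    (h1 : L * K * L = L) (h2 : K * L * K = K)
    (h3 : (L * K)ᵀ = L * K) (h4 : (K * L)ᵀ = K * L) : Kᵀ = K := by
  have h3' : Kᵀ * L = L * K := by rw [← h3, transpose_mul, hs]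
  have h4' : L * Kᵀ = K * L := by rw [← h4, transpose_mul, hs]
  have a : L * K * (K * L) = K * L := by
    rw [← h4', ← Matrix.mul_assoc, h1]
  have b : K * L * L = L := by
    have := congrArg transpose h1
    rw [Matrix.mul_assoc, transpose_mul, h4, hs] at this
    exact this
  have c : K * L * (L * K) = L * K := by
    rw [← Matrix.mul_assoc, b]
  have d : L * K = K * L := by
    have := congrArg transpose a
    rw [transpose_mul, h3, h4, c] at this
    exact this
  have e : Kᵀ * L * Kᵀ = Kᵀ := by
    have := congrArg transpose h2
    rw [transpose_mul, transpose_mul, hs, ← Matrix.mul_assoc] at this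
    exact this
  rw [← e, h3', d, Matrix.mul_assoc, h4', ← d, ← Matrix.mul_assoc, h2]

/-- The voltage value expressed through the pseudoinverse of the Laplacian. -/
theorem voltage_via_pinv
    (n : ℕ) (hn : 2 ≤ n)
    (C : Fin n → Fin n → ℝ)
    (hCsymm : ∀ p q, C p q = C q p)
    (hCnonneg : ∀ p q, 0 ≤ C p q)
    (hCdiag : ∀ p, C p p = 0)
    (hconn : (SimpleGraph.fromRel (fun p q : Fin n => 0 < C p q)).Connected)
    (L : Matrix (Fin n) (Fin n) ℝ)
    (hL : ∀ p q, L p q = if p = q then ∑ x, C p x else -C p q)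
    (Lplus : Matrix (Fin n) (Fin n) ℝ)
    (hLp1 : L * Lplus * L = L) (hLp2 : Lplus * L * Lplus = Lplus)
    (hLp3 : (L * Lplus)ᵀ = L * Lplus) (hLp4 : (Lplus * L)ᵀ = Lplus * L)
    (H : Matrix (Fin n) (Fin n) ℝ) (hH : L * H * L = L)
    (p q s : Fin n) :
    (1 / 2) * ((H q q - H q p - H p q + H p p) + (H s s - H s p - H p s + H p p)
        - (H q q - H q s - H s q + H s s))
      = Lplus p p - Lplus p q - Lplus p s + Lplus q s := by
  have hs : Lᵀ = L := by
    ext a b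
    rw [transpose_apply, hL, hL]
    by_cases h : a = b
    · subst h; rfl
    · rw [if_neg h, if_neg (Ne.symm h), hCsymm]
  have hK := pinv_symm L Lplus hs hLp1 hLp2 hLp3 hLp4
  have hKs : ∀ a b, Lplus a b = Lplus b a := fun a b => congrFun (congrFun hK b) a
  have hker := lap_ker_const n C hCsymm hCnonneg hCdiag hconn L hL
  have hD : L * ((H - Lplus) * L) = 0 := by
    rw [Matrix.sub_mul, Matrix.mul_sub, ← Matrix.mul_assoc, ← Matrix.mul_assoc, hH, hLp1, sub_self]
  have hE : ∀ a b k, ((H - Lplus) * L) a k = ((H - Lplus) * L) b k := fun a b k =>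
    hker (fun a => ((H - Lplus) * L) a k) (fun r => by
      have := congrFun (congrFun hD r) k
      rw [Matrix.mul_apply] at this
      exact this) a b
  have hF : ∀ a b k l, (H - Lplus) a k - (H - Lplus) b k = (H - Lplus) a l - (H - Lplus) b l :=
    fun a b k l => hker (fun k => (H - Lplus) a k - (H - Lplus) b k) (fun r => by
      have h := hE a b r
      rw [Matrix.mul_apply, Matrix.mul_apply, ← sub_eq_zero, ← Finset.sum_sub_distrib] at h
      rw [← h]
      refine Finset.sum_congr rfl fun x _ => ?_
      have : L r x = L x r := congrFun (congrFun hs x) r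
      rw [this]; ring) k l
  have f1 := hF p q p s
  have f2 := hF p s p q
  simp only [Matrix.sub_apply] at f1 f2
  rw [hKs s q, hKs s p, hKs q p] at *
  linarith
end

section
/- For every integer k ≥ 1, ∑_{i ∈ V} ∑_{t ∈ V} C_i · l⁺_{it} · p^{(k+1)}_{it} = 1 − tr(P^k) + ∑_{i ∈ V} ∑_{t ∈ V} C_i · l⁺_{it} · p^{(k)}_{it}. -/
open Matrix BigOperators Finset

theorem ker_const_aux (n : ℕ) (C : Fin n → Fin n → ℝ)
    (hCsymm : ∀ p q, C p q = C q p)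
    (hCnonneg : ∀ p q, 0 ≤ C p q)
    (hconn : (SimpleGraph.fromRel (fun p q : Fin n => 0 < C p q)).Connected)
    (v : Fin n → ℝ) (hv : ∀ p, ∑ q, C p q * (v p - v q) = 0) (a b : Fin n) : v a = v b := by
  have h1 : ∑ p, ∑ q, C p q * (v p - v q) * v p = 0 := by
    apply Finset.sum_eq_zero
    intro p _
    rw [← Finset.sum_mul, hv, zero_mul]
  have h2 : ∑ p, ∑ q, C p q * (v p - v q) * v q = - ∑ p, ∑ q, C p q * (v p - v q) * v p := by
    rw [Finset.sum_comm, ← Finset.sum_neg_distrib]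
    refine Finset.sum_congr rfl fun p _ => ?_
    rw [← Finset.sum_neg_distrib]
    refine Finset.sum_congr rfl fun q _ => ?_
    rw [hCsymm q p]; ring
  have h3 : ∑ p, ∑ q, C p q * (v p - v q) ^ 2 = 0 := by
    have : ∑ p, ∑ q, C p q * (v p - v q) ^ 2 =
        ∑ p, ∑ q, C p q * (v p - v q) * v p - ∑ p, ∑ q, C p q * (v p - v q) * v q := by
      simp only [← Finset.sum_sub_distrib]
      refine Finset.sum_congr rfl fun p _ => Finset.sum_congr rfl fun q _ => ?_
      ring
    rw [this, h2, h1]; simp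
  have hnn : ∀ p q, 0 ≤ C p q * (v p - v q) ^ 2 := fun p q =>
    mul_nonneg (hCnonneg p q) (sq_nonneg _)
  have h4 : ∀ p q, 0 < C p q → v p = v q := by
    intro p q hpq
    have e1 := (Finset.sum_eq_zero_iff_of_nonneg
      (fun p _ => Finset.sum_nonneg fun q _ => hnn p q)).1 h3 p (Finset.mem_univ _)
    have e2 := (Finset.sum_eq_zero_iff_of_nonneg (fun q _ => hnn p q)).1 e1 q (Finset.mem_univ _)
    rcases mul_eq_zero.1 e2 with h | h
    · exact absurd h hpq.ne'
    · exact sub_eq_zero.1 (pow_eq_zero_iff (two_ne_zero)|>.1 h)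
  obtain ⟨w⟩ := hconn.preconnected a b
  induction w with
  | nil => rfl
  | cons h _ ih =>
    rw [← ih]
    rw [SimpleGraph.fromRel_adj] at h
    rcases h.2 with h | h
    · exact h4 _ _ h
    · exact (h4 _ _ h).symm

theorem trans_matrix_recursion
    (n : ℕ) (hn : 2 ≤ n)
    (C : Fin n → Fin n → ℝ)
    (hCsymm : ∀ p q, C p q = C q p)
    (hCnonneg : ∀ p q, 0 ≤ C p q)
    (hCdiag : ∀ p, C p p = 0)
    (hconn : (SimpleGraph.fromRel (fun p q : Fin n => 0 < C p q)).Connected)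
    (L : Matrix (Fin n) (Fin n) ℝ)
    (hL : ∀ p q, L p q = if p = q then ∑ x, C p x else -C p q)
    (Lplus : Matrix (Fin n) (Fin n) ℝ)
    (hLp1 : L * Lplus * L = L) (hLp2 : Lplus * L * Lplus = Lplus)
    (hLp3 : (L * Lplus)ᵀ = L * Lplus) (hLp4 : (Lplus * L)ᵀ = Lplus * L)
    (P : Matrix (Fin n) (Fin n) ℝ)
    (hP : ∀ p q, P p q = C p q / (∑ x, C p x))
    (k : ℕ) (hk : 1 ≤ k) :
    ∑ i, ∑ t, (∑ x, C i x) * Lplus i t * (P ^ (k + 1)) i t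
      = 1 - (P ^ k).trace + ∑ i, ∑ t, (∑ x, C i x) * Lplus i t * (P ^ k) i t := by
  have hCpos : ∀ p, 0 < ∑ x, C p x := by
    intro p
    have : Nontrivial (Fin n) := Fin.nontrivial_iff_two_le.2 hn
    obtain ⟨q, hq⟩ := hconn.preconnected.exists_adj_of_nontrivial p
    rw [SimpleGraph.fromRel_adj] at hq
    have h : 0 < C p q := by
      rcases hq.2 with h | h
      · exact h
      · rw [hCsymm]; exact h
    exact Finset.sum_pos' (fun x _ => hCnonneg p x) ⟨q, Finset.mem_univ _, h⟩
  have hLD : L = Matrix.diagonal (fun p => ∑ x, C p x) * (1 - P) := by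
    ext p q
    rw [Matrix.diagonal_mul, hL, Matrix.sub_apply, hP, mul_sub, mul_div_cancel₀ _ (hCpos p).ne',
      Matrix.one_apply]
    split_ifs with h
    · subst h; simp [hCdiag]
    · simp
  have hLT : Lᵀ = L := by
    ext p q
    rw [Matrix.transpose_apply, hL, hL]
    by_cases h : p = q
    · subst h; simp
    · rw [if_neg h, if_neg (Ne.symm h), hCsymm]
  have hLv : ∀ (v : Fin n → ℝ) p, (L *ᵥ v) p = ∑ q, C p q * (v p - v q) := by
    intro v p
    have : ∀ q, L p q * v q = (if p = q then (∑ x, C p x) * v q else 0) - C p q * v q := by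
      intro q
      rw [hL]
      split_ifs with h
      · subst h; simp [hCdiag]
      · ring
    simp only [Matrix.mulVec, dotProduct, this, Finset.sum_sub_distrib, mul_sub, Finset.sum_mul]
    simp
  have hP1 : ∀ m : ℕ, (P ^ m) *ᵥ (fun _ => (1 : ℝ)) = fun _ => 1 := by
    have h1 : P *ᵥ (fun _ => (1 : ℝ)) = fun _ => 1 := by
      ext p
      simp only [Matrix.mulVec, dotProduct, hP, mul_one]
      rw [← Finset.sum_div, div_self (hCpos p).ne']
    intro m
    induction m with
    | zero => simp
    | succ m ih => rw [pow_succ, ← Matrix.mulVec_mulVec, h1, ih]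
  have hL1 : L *ᵥ (fun _ => (1 : ℝ)) = 0 := by
    ext p
    rw [hLv]; simp
  have hTL : Lplusᵀ * L = L * Lplus := by
    rw [← hLp3, Matrix.transpose_mul, hLT]
  obtain ⟨M, hM⟩ : ∃ M, M = 1 - L * Lplus := ⟨_, rfl⟩
  have hMT : Mᵀ = M := by rw [hM, Matrix.transpose_sub, hLp3, Matrix.transpose_one]
  have hLM : L * M = 0 := by
    have : M * L = 0 := by rw [hM, sub_mul, hLp1, one_mul, sub_self]
    have h2 := congrArg Matrix.transpose this
    rwa [Matrix.transpose_mul, hMT, hLT, Matrix.transpose_zero] at h2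
  have hMcol : ∀ a b j, M a j = M b j := by
    intro a b j
    refine ker_const_aux n C hCsymm hCnonneg hconn (fun i => M i j) (fun p => ?_) a b
    rw [← hLv (fun i => M i j) p]
    exact congrFun (congrFun hLM p) j
  have hMrow : ∀ a i j, M a i = M a j := by
    intro a i j
    have h1 := hMcol i j a
    rw [← hMT]; exact h1
  have hM1 : M *ᵥ (fun _ => (1 : ℝ)) = fun _ => 1 := by
    rw [hM, Matrix.sub_mulVec, ← hTL, ← Matrix.mulVec_mulVec, hL1]; simp
  have htr : (M * P ^ k).trace = 1 := by
    let z : Fin n := ⟨0, by omega⟩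
    have : (M * P ^ k).trace = ((M * P ^ k) *ᵥ (fun _ => (1 : ℝ))) z := by
      simp only [Matrix.trace, Matrix.diag, Matrix.mulVec, dotProduct, mul_one, Matrix.mul_apply]
      refine Finset.sum_congr rfl fun i _ => Finset.sum_congr rfl fun j _ => ?_
      rw [hMcol i z j]
    rw [this, ← Matrix.mulVec_mulVec, hP1, hM1]
  have hS : ∀ m : ℕ, ∑ i, ∑ t, (∑ x, C i x) * Lplus i t * (P ^ m) i t =
      (Lplusᵀ * (Matrix.diagonal (fun p => ∑ x, C p x) * P ^ m)).trace := by
    intro m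
    simp only [Matrix.trace, Matrix.diag]
    rw [Finset.sum_comm]
    refine Finset.sum_congr rfl fun i _ => ?_
    rw [Matrix.mul_apply]
    refine Finset.sum_congr rfl fun j _ => ?_
    rw [Matrix.diagonal_mul, Matrix.transpose_apply]
    ring
  have key : Lplusᵀ * (Matrix.diagonal (fun p => ∑ x, C p x) * P ^ k)
      - Lplusᵀ * (Matrix.diagonal (fun p => ∑ x, C p x) * P ^ (k + 1)) = P ^ k - M * P ^ k := by
    have : Lplusᵀ * L * P ^ k = P ^ k - M * P ^ k := by rw [hTL, hM]; noncomm_ring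
    rw [← this]
    rw [hLD, pow_succ']
    simp only [mul_sub, sub_mul, mul_one, mul_assoc]
  have key2 := congrArg Matrix.trace key
  rw [Matrix.trace_sub, Matrix.trace_sub, htr] at key2
  rw [hS, hS]
  linarith
end

section
/- For every vertex i ∈ V there is a unique vector u : V → ℝ such that L u = e − n·e^i (where e is the all-ones vector and e^i is the i-th standard basis vector of ℝ^V) and u_i = 0. (Existence and uniqueness of the equilibrium measure ν^i of V \ {i}.) -/
open Matrix BigOperators Finset

/-- Existence and uniqueness of the equilibrium measure of `V \ {i}`. -/
theorem equilibrium_measure_exists_unique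
    (n : ℕ) (hn : 2 ≤ n)
    (C : Fin n → Fin n → ℝ)
    (hCsymm : ∀ p q, C p q = C q p)
    (hCnonneg : ∀ p q, 0 ≤ C p q)
    (hCdiag : ∀ p, C p p = 0)
    (hconn : (SimpleGraph.fromRel (fun p q : Fin n => 0 < C p q)).Connected)
    (L : Matrix (Fin n) (Fin n) ℝ)
    (hL : ∀ p q, L p q = if p = q then ∑ x, C p x else -C p q)
    (i : Fin n) :
    ∃! u : Fin n → ℝ,
      L.mulVec u = (fun t => 1 - (n : ℝ) * if t = i then 1 else 0) ∧ u i = 0 := by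
  have hmul : ∀ (u : Fin n → ℝ) (p : Fin n), L.mulVec u p = ∑ q, C p q * (u p - u q) := by
    intro u p
    have h1 : ∀ q, L p q * u q = (if p = q then (∑ x, C p x) * u p else 0) - C p q * u q := by
      intro q
      rw [hL]
      by_cases h : p = q
      · subst h
        simp [hCdiag]
      · simp [h]
    simp only [Matrix.mulVec, dotProduct, h1, Finset.sum_sub_distrib, mul_sub, Finset.sum_mul]
    simp
  have hswap : ∀ f : Fin n → Fin n → ℝ, (∑ p, ∑ q, f p q) = ∑ p, ∑ q, f q p :=
    fun f => Finset.sum_comm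
  have hsum : ∀ u : Fin n → ℝ, ∑ p, L.mulVec u p = 0 := by
    intro u
    simp only [hmul]
    have h := hswap (fun p q => C p q * (u p - u q))
    have h2 : (∑ p, ∑ q, C q p * (u q - u p)) = -∑ p, ∑ q, C p q * (u p - u q) := by
      simp only [← Finset.sum_neg_distrib]
      refine Finset.sum_congr rfl fun p _ => Finset.sum_congr rfl fun q _ => ?_
      rw [hCsymm q p]; ring
    linarith
  have hker : ∀ u : Fin n → ℝ, L.mulVec u = 0 → u i = 0 → u = 0 := by
    intro u hu hui
    have h0 : (∑ p, ∑ q, C p q * (u p - u q) * u p) = 0 := by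
      refine Finset.sum_eq_zero fun p _ => ?_
      rw [← Finset.sum_mul, ← hmul, hu]; simp
    have h1 := hswap (fun p q => C p q * (u p - u q) * u p)
    have h2 : (∑ p, ∑ q, C p q * (u p - u q) ^ 2) = 0 := by
      have h3 : (∑ p, ∑ q, C p q * (u p - u q) ^ 2) =
          (∑ p, ∑ q, C p q * (u p - u q) * u p) + ∑ p, ∑ q, C q p * (u q - u p) * u q := by
        simp only [← Finset.sum_add_distrib]
        refine Finset.sum_congr rfl fun p _ => Finset.sum_congr rfl fun q _ => ?_
        rw [hCsymm q p]; ring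
      rw [h3, ← h1, h0, add_zero]
    have hnn : ∀ p q, 0 ≤ C p q * (u p - u q) ^ 2 :=
      fun p q => mul_nonneg (hCnonneg p q) (sq_nonneg _)
    have h4 : ∀ p q, C p q * (u p - u q) ^ 2 = 0 := by
      intro p q
      have h5 := (Finset.sum_eq_zero_iff_of_nonneg
        (fun p _ => Finset.sum_nonneg fun q _ => hnn p q)).1 h2 p (Finset.mem_univ p)
      exact (Finset.sum_eq_zero_iff_of_nonneg (fun q _ => hnn p q)).1 h5 q (Finset.mem_univ q)
    have hadj : ∀ p q, (SimpleGraph.fromRel (fun p q : Fin n => 0 < C p q)).Adj p q →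
        u p = u q := by
      intro p q h
      rw [SimpleGraph.fromRel_adj] at h
      have hc : C p q ≠ 0 := by
        rcases h.2 with h | h
        · exact h.ne'
        · rw [hCsymm]; exact h.ne'
      have := (mul_eq_zero.1 (h4 p q)).resolve_left hc
      exact sub_eq_zero.1 (pow_eq_zero_iff (two_ne_zero)|>.1 this)
    funext p
    obtain ⟨w⟩ := hconn.preconnected p i
    have key : ∀ a b, (SimpleGraph.fromRel (fun p q : Fin n => 0 < C p q)).Walk a b →
        u a = u b := by
      intro a b w
      induction w with
      | nil => rfl
      | cons h _ ih => exact (hadj _ _ h).trans ih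
    rw [key p i w, hui]; rfl
  let T : (Fin n → ℝ) →ₗ[ℝ] (Fin n → ℝ) :=
    L.mulVecLin + (LinearMap.single ℝ (fun _ : Fin n => ℝ) i).comp (LinearMap.proj i)
  have hT : ∀ u, T u = L.mulVec u + Pi.single i (u i) := fun u => rfl
  have hTsum : ∀ u, ∑ p, T u p = u i := by
    intro u
    simp [hT, Finset.sum_add_distrib, hsum]
  have hinj : Function.Injective T := by
    rw [injective_iff_map_eq_zero]
    intro u hu
    have h := hTsum u
    rw [hu] at h
    have hui : u i = 0 := by simpa using h.symm
    refine hker u ?_ hui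
    have := hT u
    rw [hu, hui] at this
    simpa using this.symm
  obtain ⟨u, hu⟩ := (LinearMap.injective_iff_surjective.1 hinj)
    (fun t => 1 - (n : ℝ) * if t = i then 1 else 0)
  have hui : u i = 0 := by
    rw [← hTsum u, hu]
    simp [Finset.sum_sub_distrib]
  refine ⟨u, ⟨?_, hui⟩, ?_⟩
  · rw [← hu, hT, hui]; simp
  · rintro v ⟨hv, hvi⟩
    apply hinj
    rw [hu, hT, hv, hvi]; simp
end

section
/- For all vertices i, t ∈ V, l⁺_{ii} − 2 l⁺_{it} + l⁺_{tt} = (1/n)·(ν^i_t + ν^t_i). (The resistance between i and t equals (1/n)(ν^i_t + ν^t_i).) -/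
open Matrix BigOperators Finset

/-- The resistance between `i` and `t` equals `(1/n)(ν^i_t + ν^t_i)`. -/
theorem resistance_via_equilibrium_measure
    (n : ℕ) (hn : 2 ≤ n)
    (C : Fin n → Fin n → ℝ)
    (hCsymm : ∀ p q, C p q = C q p)
    (hCnonneg : ∀ p q, 0 ≤ C p q)
    (hCdiag : ∀ p, C p p = 0)
    (hconn : (SimpleGraph.fromRel (fun p q : Fin n => 0 < C p q)).Connected)
    (L : Matrix (Fin n) (Fin n) ℝ)
    (hL : ∀ p q, L p q = if p = q then ∑ x, C p x else -C p q)
    (Lplus : Matrix (Fin n) (Fin n) ℝ)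
    (hLp1 : L * Lplus * L = L) (hLp2 : Lplus * L * Lplus = Lplus)
    (hLp3 : (L * Lplus)ᵀ = L * Lplus) (hLp4 : (Lplus * L)ᵀ = Lplus * L)
    (ν : Fin n → Fin n → ℝ)
    (hν : ∀ i, L.mulVec (ν i) = (fun t => 1 - (n : ℝ) * if t = i then 1 else 0) ∧ ν i i = 0)
    (i t : Fin n) :
    Lplus i i - 2 * Lplus i t + Lplus t t = (1 / n) * (ν i t + ν t i) := by
  have hLs : Lᵀ = L := by
    ext p q
    rw [transpose_apply, hL, hL]
    by_cases h : p = q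
    · subst h; rfl
    · rw [if_neg h, if_neg (Ne.symm h), hCsymm]
  rw [transpose_mul, hLs] at hLp3 hLp4
  have h1 : L * Lplusᵀ * L = L := by
    have := congrArg transpose hLp1
    rwa [transpose_mul, transpose_mul, hLs, ← Matrix.mul_assoc] at this
  have a1 : L * Lplus = Lplus * L * (L * Lplus) := by
    rw [← hLp4, ← Matrix.mul_assoc, h1]
  have a2 : Lplus * L = L * Lplus * (Lplus * L) := by
    rw [← hLp4, ← Matrix.mul_assoc, hLp1]
  have a3 : L * Lplus = Lplus * L := by
    have := congrArg transpose a1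
    simp only [transpose_mul, hLs] at this
    rw [hLp3, hLp4, ← a2] at this
    exact this
  have h2 : Lplusᵀ * L * Lplusᵀ = Lplusᵀ := by
    have := congrArg transpose hLp2
    rwa [transpose_mul, transpose_mul, hLs, ← Matrix.mul_assoc] at this
  have hs : Lplusᵀ = Lplus := by
    calc Lplusᵀ = Lplusᵀ * L * Lplusᵀ := h2.symm
      _ = Lplusᵀ * L * Lplus := by
        rw [Matrix.mul_assoc, hLp4, ← a3, ← Matrix.mul_assoc]
      _ = Lplus := by rw [hLp3, a3, hLp2]
  have hit : Lplus t i = Lplus i t := congrFun (congrFun hs i) t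
  have hn0 : (n : ℝ) ≠ 0 := by
    have : n ≠ 0 := by omega
    exact_mod_cast this
  let w : Fin n → ℝ := ν t - ν i
  let d : Fin n → ℝ := Pi.single i 1 - Pi.single t 1
  have hw : L *ᵥ w = (n : ℝ) • d := by
    ext x
    simp only [w, d, mulVec_sub, (hν t).1, (hν i).1, Pi.sub_apply, Pi.smul_apply, smul_eq_mul,
      Pi.single_apply]
    ring
  have hw' : w ᵥ* L = (n : ℝ) • d := by
    rw [← mulVec_transpose, hLs, hw]
  have e1 : (w ᵥ* L) ⬝ᵥ (Lplus *ᵥ (L *ᵥ w)) = w ⬝ᵥ (L *ᵥ w) := by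
    rw [← dotProduct_mulVec, mulVec_mulVec, mulVec_mulVec, hLp1]
  rw [hw', hw] at e1
  have e2 : d ⬝ᵥ (Lplus *ᵥ d) = Lplus i i - 2 * Lplus i t + Lplus t t := by
    simp [d, mulVec_sub, sub_dotProduct, hit]
    ring
  have e3 : w ⬝ᵥ d = ν i t + ν t i := by
    simp [d, w, dotProduct_sub, (hν i).2, (hν t).2]
    ring
  simp only [mulVec_smul, smul_dotProduct, dotProduct_smul, smul_eq_mul] at e1
  rw [e2, e3] at e1
  have e4 := mul_left_cancel₀ hn0 e1
  rw [← e4]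
  field_simp
end

section
/- For all vertices i, s, t ∈ V, 2·(l⁺_{ii} − l⁺_{is} − l⁺_{it} + l⁺_{st}) = (1/n)·(ν^i_s + ν^s_i + ν^i_t + ν^t_i − ν^s_t − ν^t_s). (The voltage value 2 j_i(s,t) expressed through equilibrium measures.) -/
open Matrix BigOperators Finset

/-- The voltage value `2 j_i(s,t)` expressed through equilibrium measures. -/
theorem voltage_via_equilibrium_measure
    (n : ℕ) (hn : 2 ≤ n)
    (C : Fin n → Fin n → ℝ)
    (hCsymm : ∀ p q, C p q = C q p)
    (hCnonneg : ∀ p q, 0 ≤ C p q)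
    (hCdiag : ∀ p, C p p = 0)
    (hconn : (SimpleGraph.fromRel (fun p q : Fin n => 0 < C p q)).Connected)
    (L : Matrix (Fin n) (Fin n) ℝ)
    (hL : ∀ p q, L p q = if p = q then ∑ x, C p x else -C p q)
    (Lplus : Matrix (Fin n) (Fin n) ℝ)
    (hLp1 : L * Lplus * L = L) (hLp2 : Lplus * L * Lplus = Lplus)
    (hLp3 : (L * Lplus)ᵀ = L * Lplus) (hLp4 : (Lplus * L)ᵀ = Lplus * L)
    (ν : Fin n → Fin n → ℝ)
    (hν : ∀ i, L.mulVec (ν i) = (fun t => 1 - (n : ℝ) * if t = i then 1 else 0) ∧ ν i i = 0)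
    (i s t : Fin n) :
    2 * (Lplus i i - Lplus i s - Lplus i t + Lplus s t)
      = (1 / n) * (ν i s + ν s i + ν i t + ν t i - ν s t - ν t s) := by
  have hn0 : (n : ℝ) ≠ 0 := by
    have : n ≠ 0 := by omega
    exact_mod_cast this
  have hLs : Lᵀ = L := by
    ext p q
    rw [transpose_apply, hL, hL]
    by_cases h : p = q
    · subst h; rfl
    · rw [if_neg h, if_neg (Ne.symm h), hCsymm]
  have hL1 : L *ᵥ (fun _ => (1 : ℝ)) = 0 := by
    ext p
    have h1 : ∀ q, L p q = (if p = q then ∑ x, C p x else 0) - C p q := by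
      intro q
      rw [hL]
      by_cases h : p = q
      · subst h; simp [hCdiag]
      · simp [h]
    simp [mulVec, dotProduct, h1, Finset.sum_sub_distrib]
  -- the kernel of `L` consists of constants
  have hker : ∀ w : Fin n → ℝ, L *ᵥ w = 0 → ∀ j, ∑ k, w k = n * w j := by
    intro w hw j
    have h1 : w ⬝ᵥ (L *ᵥ ν j) = 0 := by
      rw [dotProduct_mulVec, ← mulVec_transpose, hLs, hw, zero_dotProduct]
    rw [(hν j).1] at h1
    simp [dotProduct, mul_sub, Finset.sum_sub_distrib] at h1
    linarith
  have a3 : Lplusᵀ * L = L * Lplus := by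
    rw [← hLp3, transpose_mul, hLs]
  have a4 : L * Lplusᵀ = Lplus * L := by
    rw [← hLp4, transpose_mul, hLs]
  have a1 : L * Lplusᵀ * L = L := by
    have := congrArg transpose hLp1
    simpa [transpose_mul, hLs, Matrix.mul_assoc] using this
  have a2 : Lplusᵀ * L * Lplusᵀ = Lplusᵀ := by
    have := congrArg transpose hLp2
    simpa [transpose_mul, hLs, Matrix.mul_assoc] using this
  have hcomm : L * Lplus = Lplus * L := by
    calc L * Lplus = (L * Lplusᵀ * L) * Lplus := by rw [a1]
      _ = Lplus * L * (L * Lplus) := by rw [a4, Matrix.mul_assoc]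
      _ = Lplus * (L * Lplusᵀ * L) := by rw [← a3]; simp only [Matrix.mul_assoc]
      _ = Lplus * L := by rw [a1]
  have hsym : Lplusᵀ = Lplus := by
    calc Lplusᵀ = Lplusᵀ * L * Lplusᵀ := a2.symm
      _ = Lplus * (L * Lplusᵀ) := by rw [a3, hcomm, Matrix.mul_assoc]
      _ = Lplus * L * Lplus := by rw [a4, ← hcomm, ← Matrix.mul_assoc, hcomm]
      _ = Lplus := hLp2
  have hsy : ∀ p q, Lplus p q = Lplus q p := fun p q => by
    conv_lhs => rw [← hsym]
    rfl
  have hP1 : Lplus *ᵥ (fun _ => (1 : ℝ)) = 0 := by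
    rw [← hLp2, Matrix.mul_assoc, hcomm, ← mulVec_mulVec, ← mulVec_mulVec, hL1]
    simp
  have hrow : ∀ j, ∑ k, Lplus j k = 0 := fun j => by
    have := congrFun hP1 j
    simpa [mulVec, dotProduct] using this
  have key : ∀ a b, ν a b = n * (Lplus a a - Lplus b a) := by
    intro a b
    have hw : L *ᵥ (ν a - Lplus *ᵥ (L *ᵥ ν a)) = 0 := by
      rw [mulVec_sub, mulVec_mulVec, mulVec_mulVec, hLp1, sub_self]
    have hv : ∀ j, (Lplus *ᵥ (L *ᵥ ν a)) j = - (n * Lplus j a) := by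
      intro j
      rw [(hν a).1]
      simp [mulVec, dotProduct, mul_sub, Finset.sum_sub_distrib, hrow, mul_comm]
    have h := (hker _ hw a).symm.trans (hker _ hw b)
    have h := mul_left_cancel₀ hn0 h
    rw [Pi.sub_apply, Pi.sub_apply, hv, hv, (hν a).2] at h
    linarith
  simp only [key]
  rw [hsy s i, hsy t i, hsy t s]
  field_simp
  ring
end

section
/- For every integer k ≥ 1, (1/n) ∑_{i ∈ V} ∑_{t ∈ V} C_i · ν^i_t · p^{(k)}_{it} = n − k + ∑_{m=1}^{k−1} tr(P^m). -/
open Matrix BigOperators Finset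

theorem equilibrium_measure_foster
    (n : ℕ) (hn : 2 ≤ n)
    (C : Fin n → Fin n → ℝ)
    (hCsymm : ∀ p q, C p q = C q p)
    (hCnonneg : ∀ p q, 0 ≤ C p q)
    (hCdiag : ∀ p, C p p = 0)
    (hconn : (SimpleGraph.fromRel (fun p q : Fin n => 0 < C p q)).Connected)
    (L : Matrix (Fin n) (Fin n) ℝ)
    (hL : ∀ p q, L p q = if p = q then ∑ x, C p x else -C p q)
    (P : Matrix (Fin n) (Fin n) ℝ)
    (hP : ∀ p q, P p q = C p q / (∑ x, C p x))
    (ν : Fin n → Fin n → ℝ)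
    (hν : ∀ i, L.mulVec (ν i) = (fun t => 1 - (n : ℝ) * if t = i then 1 else 0) ∧ ν i i = 0)
    (k : ℕ) (hk : 1 ≤ k) :
    (1 / n) * ∑ i, ∑ t, (∑ x, C i x) * ν i t * (P ^ k) i t
      = (n : ℝ) - (k : ℝ) + ∑ m ∈ Finset.Icc 1 (k - 1), (P ^ m).trace := by
  have hnt : Nontrivial (Fin n) := Fin.nontrivial_iff_two_le.mpr hn
  have hpos : ∀ i, 0 < ∑ x, C i x := by
    intro i
    obtain ⟨j, hj⟩ := hconn.preconnected.exists_adj_of_nontrivial i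
    rw [SimpleGraph.fromRel_adj] at hj
    have hij : 0 < C i j := by
      rcases hj.2 with h | h
      · exact h
      · rw [hCsymm]; exact h
    exact lt_of_lt_of_le hij
      (Finset.single_le_sum (f := fun x => C i x) (fun x _ => hCnonneg i x) (Finset.mem_univ j))
  have hrow : ∀ (m : ℕ) i, ∑ t, (P ^ m) i t = 1 := by
    intro m
    induction m with
    | zero => intro i; simp [Matrix.one_apply]
    | succ m ih =>
      intro i
      simp_rw [pow_succ, Matrix.mul_apply]
      rw [Finset.sum_comm]
      rw [← ih i]
      refine Finset.sum_congr rfl fun j _ => ?_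
      rw [← Finset.mul_sum]
      simp_rw [hP]
      rw [← Finset.sum_div, div_self (hpos j).ne', mul_one]
  have hrev : ∀ (m : ℕ) i t, (∑ x, C i x) * (P ^ m) i t = (∑ x, C t x) * (P ^ m) t i := by
    intro m
    induction m with
    | zero =>
      intro i t
      by_cases h : i = t
      · subst h; rfl
      · simp [Matrix.one_apply, h, Ne.symm h]
    | succ m ih =>
      intro i t
      rw [pow_succ, Matrix.mul_apply, ← pow_succ, pow_succ', Matrix.mul_apply,
        Finset.mul_sum, Finset.mul_sum]
      refine Finset.sum_congr rfl fun j _ => ?_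
      rw [← mul_assoc, ih i j, hP, hP, hCsymm j t]
      have h1 := (hpos j).ne'
      have h2 := (hpos t).ne'
      field_simp
  have hPν : ∀ i s, ∑ t, P s t * ν i t
      = ν i s - (1 - (n : ℝ) * if s = i then 1 else 0) / (∑ x, C s x) := by
    intro i s
    have h := congrFun (hν i).1 s
    have h2 : L.mulVec (ν i) s = (∑ x, C s x) * ν i s - ∑ t, C s t * ν i t := by
      have h3 : ∀ t, L s t = (if s = t then ∑ x, C s x else 0) - C s t := by
        intro t
        rw [hL]
        by_cases hst : s = t
        · subst hst; simp [hCdiag]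
        · simp [hst]
      simp [Matrix.mulVec, dotProduct, h3, sub_mul, Finset.sum_sub_distrib]
    rw [h2] at h
    rw [← h]
    simp_rw [hP, div_mul_eq_mul_div]
    rw [← Finset.sum_div]
    have h1 := (hpos s).ne'
    field_simp
    ring
  have hn0 : (n : ℝ) ≠ 0 := by positivity
  have key : ∀ m : ℕ, ∑ i, ∑ t, (∑ x, C i x) * ν i t * (P ^ m) i t
      = n * (-(m : ℝ) + ∑ j ∈ Finset.range m, (P ^ j).trace) := by
    intro m
    induction m with
    | zero =>
      simp [Matrix.one_apply, (hν _).2]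
    | succ m ih =>
      have hstep : ∀ i, ∑ t, (∑ x, C i x) * ν i t * (P ^ (m + 1)) i t
          = ∑ t, (∑ x, C i x) * ν i t * (P ^ m) i t
            - (∑ s, (P ^ m) s i) + n * (P ^ m) i i := by
        intro i
        have e1 : ∑ t, (∑ x, C i x) * ν i t * (P ^ (m + 1)) i t
            = ∑ s, (∑ x, C i x) * (P ^ m) i s * ∑ t, P s t * ν i t := by
          simp_rw [pow_succ, Matrix.mul_apply, Finset.mul_sum]
          rw [Finset.sum_comm]
          refine Finset.sum_congr rfl fun s _ => Finset.sum_congr rfl fun t _ => ?_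
          ring
        have e2 : ∀ s, (∑ x, C i x) * (P ^ m) i s * ∑ t, P s t * ν i t
            = (∑ x, C i x) * ν i s * (P ^ m) i s - (P ^ m) s i
              + (if s = i then n * (P ^ m) s i else 0) := by
          intro s
          have h1 := (hpos s).ne'
          rw [hPν, mul_sub, hrev m i s]
          have e3 : (∑ x, C i x) * ν i s * (P ^ m) i s
              = (∑ x, C s x) * (P ^ m) s i * ν i s := by
            rw [← hrev m i s]; ring
          rw [e3]
          split_ifs <;> field_simp <;> ring
        rw [e1, Finset.sum_congr rfl fun s _ => e2 s, Finset.sum_add_distrib,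
          Finset.sum_sub_distrib]
        simp
      rw [Finset.sum_congr rfl fun i _ => hstep i, Finset.sum_add_distrib,
        Finset.sum_sub_distrib, ih, Finset.sum_comm, Finset.sum_congr rfl fun s _ => hrow m s,
        ← Finset.mul_sum, Finset.sum_range_succ]
      simp only [Matrix.trace, Matrix.diag_apply, Finset.sum_const, Finset.card_univ,
        Fintype.card_fin, nsmul_eq_mul]
      push_cast
      ring
  rw [key k]
  obtain ⟨k, rfl⟩ : ∃ j, k = j + 1 := ⟨k - 1, by omega⟩
  have hI : Finset.Icc 1 (k + 1 - 1) = Finset.Ico 1 (k + 1) := by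
    ext x; simp only [Finset.mem_Icc, Finset.mem_Ico]; omega
  rw [hI, Finset.range_eq_Ico, Finset.sum_eq_sum_Ico_succ_bot (Nat.succ_pos k)]
  simp only [pow_zero, Matrix.trace_one, Fintype.card_fin]
  field_simp
  ring
end
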